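/- Let J be a finite unit-job instance. Then J admits a schedule on the machine profile t ↦ ⌈e · OFF(t)⌉; that is, there exists σ : J → ℕ such that for every job j ∈ J, r j ≤ σ j < d j, and for every time slot t ∈ ℕ, the number of jobs j with σ j = t is at most ⌈e · OFF(t)⌉, where e = Real.exp 1. -/

import Mathlib

/-- `IsSchedule J r d m σ` : `σ` is a schedule of the unit-job instance `J`
(with release times `r` and deadlines `d`) on the machine profile `m`. -/
def IsSchedule {ι : Type*} [DecidableEq ι] (J : Finset ι) (r d : ι → ℕ)
    (m : ℕ → ℕ) (σ : ι → ℕ) : Prop :=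
  (∀ j ∈ J, r j ≤ σ j ∧ σ j < d j) ∧
    ∀ t : ℕ, (J.filter (fun j => σ j = t)).card ≤ m t

/-- `OFF J r d t` : the least number `m` of machines such that the jobs of `J`
released by time `t` admit a schedule on the constant machine profile `m`. -/
noncomputable def OFF {ι : Type*} [DecidableEq ι] (J : Finset ι) (r d : ι → ℕ)
    (t : ℕ) : ℕ :=
  sInf {m : ℕ | ∃ σ : ι → ℕ, IsSchedule (J.filter (fun j => r j ≤ t)) r d (fun _ => m) σ}

open MeasureTheory

section Hall

/-- A family of slot intervals whose jobs satisfy the counting condition on every interval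
satisfies the counting condition on the union of the intervals. -/
lemma card_le_sum_biUnion_Ico {ι : Type*} (r d : ι → ℕ) (m : ℕ → ℕ) (S : Finset ι)
    (hrd : ∀ j ∈ S, r j < d j)
    (h : ∀ a b, (S.filter (fun j => a ≤ r j ∧ d j ≤ b)).card ≤ ∑ t ∈ Finset.Ico a b, m t) :
    S.card ≤ ∑ t ∈ S.biUnion (fun j => Finset.Ico (r j) (d j)), m t := by
  induction hn : S.card using Nat.strong_induction_on generalizing S with
  | _ n ih =>
    subst hn
    rcases S.eq_empty_or_nonempty with rfl | hS
    · simp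
    obtain ⟨j₀, hj₀, hmin⟩ := S.exists_min_image r hS
    set U := S.biUnion (fun j => Finset.Ico (r j) (d j)) with hU
    have hex : ∃ b, r j₀ ≤ b ∧ b ∉ U := by
      obtain ⟨b, hb⟩ := Infinite.exists_notMem_finset (U ∪ Finset.range (r j₀))
      simp only [Finset.mem_union, Finset.mem_range, not_or, not_lt] at hb
      exact ⟨b, hb.2, hb.1⟩
    classical
    obtain ⟨hab, hbU⟩ := Nat.find_spec hex
    have hlt : ∀ t, r j₀ ≤ t → t < Nat.find hex → t ∈ U := fun t ht htb => by
      by_contra hc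
      exact Nat.find_min hex htb ⟨ht, hc⟩
    generalize Nat.find hex = b at hab hbU hlt
    have hnot : ∀ j ∈ S, r j ≤ b → d j ≤ b := fun j hj hr => by
      by_contra hc
      exact hbU (Finset.mem_biUnion.2 ⟨j, hj, Finset.mem_Ico.2 ⟨hr, not_le.1 hc⟩⟩)
    have hleft : (S.filter (fun j => r j < b)).card ≤ ∑ t ∈ Finset.Ico (r j₀) b, m t := by
      refine le_trans (Finset.card_le_card fun j hj => ?_) (h (r j₀) b)
      rw [Finset.mem_filter] at hj ⊢
      exact ⟨hj.1, hmin j hj.1, hnot j hj.1 hj.2.le⟩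
    have hsub : S.filter (fun j => ¬ r j < b) ⊆ S := Finset.filter_subset _ _
    have hright : (S.filter (fun j => ¬ r j < b)).card ≤
        ∑ t ∈ (S.filter (fun j => ¬ r j < b)).biUnion (fun j => Finset.Ico (r j) (d j)), m t := by
      refine ih _ (Finset.card_lt_card ⟨hsub, fun hc => ?_⟩) _ (fun j hj => hrd j (hsub hj))
        (fun a c => ?_) rfl
      · have := (Finset.mem_filter.1 (hc hj₀)).2
        have := hnot j₀ hj₀ hab
        have := hrd j₀ hj₀
        omega
      · exact le_trans (Finset.card_le_card (Finset.filter_subset_filter _ hsub)) (h a c)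
    rw [← Finset.card_filter_add_card_filter_not (fun j => r j < b)]
    refine (add_le_add hleft hright).trans ?_
    rw [← Finset.sum_union]
    · refine Finset.sum_le_sum_of_subset (Finset.union_subset (fun t ht => ?_)
        (Finset.biUnion_subset_biUnion_of_subset_left _ hsub))
      rw [Finset.mem_Ico] at ht
      exact hlt t ht.1 ht.2
    · rw [Finset.disjoint_left]
      intro t ht ht'
      simp only [Finset.mem_biUnion, Finset.mem_filter, Finset.mem_Ico] at ht ht'
      obtain ⟨j, ⟨-, hj⟩, hj'⟩ := ht'
      omega

/-- Hall's condition for unit jobs: it suffices to count jobs inside every interval. -/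
lemma exists_isSchedule_of_card_le {ι : Type*} [DecidableEq ι] (J : Finset ι) (r d : ι → ℕ)
    (m : ℕ → ℕ) (hrd : ∀ j ∈ J, r j < d j)
    (h : ∀ a b, (J.filter (fun j => a ≤ r j ∧ d j ≤ b)).card ≤ ∑ t ∈ Finset.Ico a b, m t) :
    ∃ σ : ι → ℕ, IsSchedule J r d m σ := by
  let slots : J → Finset (Σ _ : ℕ, ℕ) := fun j =>
    (Finset.Ico (r j) (d j)).sigma fun t => Finset.range (m t)
  have hall : ∀ S : Finset J, S.card ≤ (S.biUnion slots).card := by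
    intro S
    have hSJ : S.map (Function.Embedding.subtype _) ⊆ J := fun j hj => by
      obtain ⟨x, -, rfl⟩ := Finset.mem_map.1 hj
      exact x.2
    have key := card_le_sum_biUnion_Ico r d m (S.map (Function.Embedding.subtype _))
      (fun j hj => hrd j (hSJ hj)) (fun a b =>
        le_trans (Finset.card_le_card (Finset.filter_subset_filter _ hSJ)) (h a b))
    rw [Finset.card_map] at key
    refine key.trans (le_of_eq ?_)
    have : S.biUnion slots = ((S.map (Function.Embedding.subtype _)).biUnion
        (fun j => Finset.Ico (r j) (d j))).sigma fun t => Finset.range (m t) := by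
      ext ⟨t, i⟩
      simp only [slots, Finset.mem_biUnion, Finset.mem_sigma, Finset.mem_map,
        Function.Embedding.coe_subtype]
      constructor
      · rintro ⟨j, hj, ht, hi⟩
        exact ⟨⟨j, ⟨j, hj, rfl⟩, ht⟩, hi⟩
      · rintro ⟨⟨_, ⟨j, hj, rfl⟩, ht⟩, hi⟩
        exact ⟨j, hj, ht, hi⟩
    rw [this, Finset.card_sigma]
    simp
  obtain ⟨f, hf, hmem⟩ := (Finset.all_card_le_biUnion_card_iff_exists_injective slots).1 hall
  simp only [slots, Finset.mem_sigma, Finset.mem_Ico, Finset.mem_range] at hmem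
  refine ⟨fun j => if hj : j ∈ J then (f ⟨j, hj⟩).1 else 0, fun j hj => ?_, fun t => ?_⟩
  · simpa [hj] using (hmem ⟨j, hj⟩).1
  · rw [← Finset.card_range (m t)]
    refine Finset.card_le_card_of_injOn
      (fun j => if hj : j ∈ J then (f ⟨j, hj⟩).2 else 0) ?_ ?_
    · intro j hj
      rw [Finset.mem_coe, Finset.mem_filter] at hj
      obtain ⟨hj, rfl⟩ := hj
      simpa [hj] using (hmem ⟨j, hj⟩).2
    · intro j hj k hk hjk
      rw [Finset.mem_coe, Finset.mem_filter] at hj hk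
      obtain ⟨hj, hjt⟩ := hj
      obtain ⟨hk, hkt⟩ := hk
      simp only [hj, hk, dite_true] at hjt hkt hjk
      have := hf (Sigma.ext (hjt.trans hkt.symm) (heq_of_eq hjk))
      simpa using this

end Hall

section Averaging

/-- The density `v⁻¹` cut off below `c`. -/
noncomputable def cutoffInv (c : ℝ) : ℝ → ℝ :=
  (Set.Ici c).indicator fun v => (max v c)⁻¹

lemma intervalIntegrable_cutoffInv {c : ℝ} (hc : 0 < c) (a b : ℝ) :
    IntervalIntegrable (cutoffInv c) volume a b := by
  have hcont : Continuous fun v : ℝ => (max v c)⁻¹ :=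
    (continuous_id.max continuous_const).inv₀ fun v => (lt_max_of_lt_right hc).ne'
  have := hcont.intervalIntegrable (μ := volume) a b
  exact ⟨this.1.indicator measurableSet_Ici, this.2.indicator measurableSet_Ici⟩

lemma integral_cutoffInv {y : ℝ} (hy : 0 < y) :
    ∫ v in (0 : ℝ)..y, cutoffInv (y / Real.exp 1) v = 1 := by
  have hc : 0 < y / Real.exp 1 := by positivity
  have hle : y / Real.exp 1 ≤ y := div_le_self hy.le (Real.one_le_exp zero_le_one)
  rw [← intervalIntegral.integral_add_adjacent_intervals
    (intervalIntegrable_cutoffInv hc 0 (y / Real.exp 1)) (intervalIntegrable_cutoffInv hc _ y)]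
  have hzero : ∫ v in (0 : ℝ)..(y / Real.exp 1), cutoffInv (y / Real.exp 1) v = 0 := by
    rw [intervalIntegral.integral_congr_Ioo_of_le (g := fun _ => 0) hc.le]
    · simp
    · intro v hv
      exact Set.indicator_of_notMem (by simpa using hv.2) _
  have hone : ∫ v in (y / Real.exp 1)..y, cutoffInv (y / Real.exp 1) v =
      ∫ v in (y / Real.exp 1)..y, v⁻¹ := by
    refine intervalIntegral.integral_congr fun v hv => ?_
    rw [Set.uIcc_of_le hle] at hv
    simp [cutoffInv, hv.1]
  rw [hzero, hone, integral_inv_of_pos hc hy, div_div_cancel₀ hy.ne', Real.log_exp, zero_add]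

/-- If each `M i` dominates the density of the values `y j` in every window `(i, k]`, then
`e` times the total of the `M i` dominates the number of values. -/
lemma card_le_exp_one_mul_sum {ι : Type*} (A : Finset ι) (y : ι → ℕ) (M : ℕ → ℝ) (n : ℕ)
    (hpos : ∀ j ∈ A, 0 < y j) (hyn : ∀ j ∈ A, y j ≤ n)
    (hM : ∀ i < n, ∀ k, ((A.filter fun j => i < y j ∧ y j ≤ k).card : ℝ) ≤ M i * k) :
    (A.card : ℝ) ≤ Real.exp 1 * ∑ i ∈ Finset.range n, M i := by
  have hc : ∀ j ∈ A, 0 < (y j : ℝ) / Real.exp 1 := fun j hj => by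
    have : (0 : ℝ) < y j := by exact_mod_cast hpos j hj
    positivity
  have hjob : ∀ j ∈ A, (1 : ℝ) = ∑ i ∈ Finset.range n,
      if i < y j then ∫ v in (i : ℝ)..((i + 1 : ℕ) : ℝ), cutoffInv (y j / Real.exp 1) v
        else 0 := by
    intro j hj
    refine (integral_cutoffInv (y := y j) (by exact_mod_cast hpos j hj)).symm.trans ?_
    rw [← Finset.sum_filter]
    have hfil : (Finset.range n).filter (fun i => i < y j) = Finset.range (y j) := by
      ext i
      have := hyn j hj
      simp only [Finset.mem_filter, Finset.mem_range]
      omega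
    rw [hfil, intervalIntegral.sum_integral_adjacent_intervals (a := fun i : ℕ => (i : ℝ))
      (fun i _ => intervalIntegrable_cutoffInv (hc j hj) _ _), Nat.cast_zero]
  have hslot : ∀ i ∈ Finset.range n, (∑ j ∈ A,
      if i < y j then ∫ v in (i : ℝ)..((i + 1 : ℕ) : ℝ), cutoffInv (y j / Real.exp 1) v
        else 0) ≤ Real.exp 1 * M i := by
    intro i hi
    have hint : ∀ j ∈ A.filter (fun j => i < y j), IntervalIntegrable
        (cutoffInv (y j / Real.exp 1)) volume (i : ℝ) ((i + 1 : ℕ) : ℝ) := fun j hj =>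
      intervalIntegrable_cutoffInv (hc j (Finset.mem_filter.1 hj).1) _ _
    rw [← Finset.sum_filter, ← intervalIntegral.integral_finsetSum hint]
    have hM0 : 0 ≤ M i := by simpa using (Nat.cast_nonneg _).trans (hM i (Finset.mem_range.1 hi) 1)
    calc _ ≤ ∫ v in (i : ℝ)..((i + 1 : ℕ) : ℝ), Real.exp 1 * M i := by
          refine intervalIntegral.integral_mono_on_of_le_Ioo (by simp)
            (by simpa only [← Finset.sum_apply] using IntervalIntegrable.sum _ hint) (by simp) fun v hv => ?_
          have hv0 : 0 < v := (Nat.cast_nonneg i).trans_lt hv.1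
          have hterm : ∀ j ∈ A.filter (fun j => i < y j), cutoffInv (y j / Real.exp 1) v =
              if y j ≤ ⌊Real.exp 1 * v⌋₊ then v⁻¹ else 0 := by
            intro j hj
            have hiff : y j ≤ ⌊Real.exp 1 * v⌋₊ ↔ (y j : ℝ) / Real.exp 1 ≤ v := by
              rw [Nat.le_floor_iff (by positivity), div_le_iff₀' (Real.exp_pos 1)]
            simp only [hiff, cutoffInv, Set.indicator_apply, Set.mem_Ici]
            split_ifs with h
            · rw [max_eq_left h]
            · rfl
          rw [Finset.sum_congr rfl hterm, ← Finset.sum_filter, Finset.filter_filter,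
            Finset.sum_const, nsmul_eq_mul, ← div_eq_mul_inv, div_le_iff₀ hv0]
          calc _ ≤ M i * (⌊Real.exp 1 * v⌋₊ : ℝ) := hM i (Finset.mem_range.1 hi) _
            _ ≤ M i * (Real.exp 1 * v) := by
              gcongr
              exact Nat.floor_le (by positivity)
            _ = Real.exp 1 * M i * v := by ring
      _ = Real.exp 1 * M i := by simp
  calc (A.card : ℝ) = ∑ j ∈ A, (1 : ℝ) := by simp
    _ = _ := Finset.sum_congr rfl hjob
    _ = _ := Finset.sum_comm
    _ ≤ _ := Finset.sum_le_sum hslot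
    _ = _ := (Finset.mul_sum _ _ _).symm

end Averaging

lemma OFF_spec {ι : Type*} [DecidableEq ι] (J : Finset ι) (r d : ι → ℕ)
    (hrd : ∀ j ∈ J, r j < d j) (t : ℕ) :
    ∃ σ : ι → ℕ, IsSchedule (J.filter (fun j => r j ≤ t)) r d (fun _ => OFF J r d t) σ := by
  refine Nat.sInf_mem (s := {m : ℕ | ∃ σ : ι → ℕ,
    IsSchedule (J.filter (fun j => r j ≤ t)) r d (fun _ => m) σ})
    ⟨(J.filter (fun j => r j ≤ t)).card, r, fun j hj => ?_, fun _ => ?_⟩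
  · exact ⟨le_rfl, hrd j (Finset.mem_filter.1 hj).1⟩
  · exact Finset.card_le_card (Finset.filter_subset _ _)

/-- The jobs released during `[s, t]` and due by `b` all run during `[s, b)`. -/
lemma card_filter_le_OFF_mul {ι : Type*} [DecidableEq ι] (J : Finset ι) (r d : ι → ℕ)
    (hrd : ∀ j ∈ J, r j < d j) (s t b : ℕ) :
    (J.filter (fun j => s ≤ r j ∧ r j ≤ t ∧ d j ≤ b)).card ≤ OFF J r d t * (b - s) := by
  obtain ⟨σ, hσ, hcard⟩ := OFF_spec J r d hrd t
  rw [← Nat.card_Ico s b]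
  refine Finset.card_le_mul_card_image_of_maps_to (f := σ) (fun j hj => ?_) _ fun x _ => ?_
  · rw [Finset.mem_filter] at hj
    have := hσ j (Finset.mem_filter.2 ⟨hj.1, hj.2.2.1⟩)
    rw [Finset.mem_Ico]
    omega
  · refine (Finset.card_le_card fun j hj => ?_).trans (hcard x)
    simp only [Finset.mem_filter] at hj ⊢
    exact ⟨⟨hj.1.1, hj.1.2.2.1⟩, hj.2⟩

/-- Any finite unit-job instance admits a schedule on the machine profile
`t ↦ ⌈e · OFF(t)⌉`. -/
theorem exists_schedule_on_e_off {ι : Type*} [DecidableEq ι]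
    (J : Finset ι) (r d : ι → ℕ) (hrd : ∀ j ∈ J, r j < d j) :
    ∃ σ : ι → ℕ,
      IsSchedule J r d (fun t => ⌈Real.exp 1 * (OFF J r d t : ℝ)⌉₊) σ := by
  refine exists_isSchedule_of_card_le J r d _ hrd fun a b => ?_
  have key := card_le_exp_one_mul_sum (J.filter (fun j => a ≤ r j ∧ d j ≤ b))
    (fun j => b - r j) (fun i => OFF J r d (b - 1 - i)) (b - a)
    (fun j hj => by
      rw [Finset.mem_filter] at hj
      have := hrd j hj.1
      omega)
    (fun j hj => by
      rw [Finset.mem_filter] at hj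
      omega)
    (fun i hi k => by
      have hk : OFF J r d (b - 1 - i) * (b - (b - k)) ≤ OFF J r d (b - 1 - i) * k :=
        Nat.mul_le_mul_left _ (by omega)
      have hcard := (card_filter_le_OFF_mul J r d hrd (b - k) (b - 1 - i) b).trans hk
      rw [← Nat.cast_mul, Nat.cast_le]
      refine (Finset.card_le_card fun j hj => ?_).trans hcard
      simp only [Finset.mem_filter] at hj ⊢
      exact ⟨hj.1.1, by omega, by omega, hj.1.2.2⟩)
  have hreflect : ∑ i ∈ Finset.range (b - a), (OFF J r d (b - 1 - i) : ℝ) =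
      ∑ t ∈ Finset.Ico a b, (OFF J r d t : ℝ) := by
    rw [Finset.sum_Ico_eq_sum_range, ← Finset.sum_range_reflect]
    refine Finset.sum_congr rfl fun i hi => ?_
    rw [Finset.mem_range] at hi
    congr 2
    omega
  rw [hreflect, Finset.mul_sum] at key
  have := key.trans (Finset.sum_le_sum fun t _ => Nat.le_ceil (Real.exp 1 * (OFF J r d t : ℝ)))
  exact_mod_cast this
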